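/- arXiv:1801.08177 — 7 statements merged into one kernel-verified Lean document; each statement's English description precedes it below -/
import Mathlib

section
/- Let Y and G be independent random variables on a probability space, where Y is exponentially distributed with mean a > 0 (rate 1/a) and G is exponentially distributed with mean b > 0 (rate 1/b). Let τ > 0, c > 0 and θ ≥ τ. Then ℙ( Y > θ and G < (Y − τ)/c ) = e^{−θ/a} − (c·b/(a + c·b)) · e^{ τ/(c·b) − θ·(a + c·b)/(c·b·a) }. -/
open MeasureTheory ProbabilityTheory Real

theorem expMeasure_eq_withDensity (r : ℝ) :
    expMeasure r = volume.withDensity (exponentialPDF r) := rfl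

theorem expMeasure_Iio {r x : ℝ} (hr : 0 < r) (hx : 0 ≤ x) :
    expMeasure r (Set.Iio x) = ENNReal.ofReal (1 - exp (-(r * x))) := by
  rw [expMeasure_eq_withDensity, measure_congr Iio_ae_eq_Iic,
    withDensity_apply _ measurableSet_Iic, lintegral_exponentialPDF_eq_antiDeriv hr, if_pos hx]

theorem setLIntegral_Ioi_expMeasure {r θ : ℝ} (hθ : 0 ≤ θ) {f : ℝ → ENNReal}
    (hf : Measurable f) :
    ∫⁻ y in Set.Ioi θ, f y ∂expMeasure r
      = ∫⁻ y in Set.Ioi θ, ENNReal.ofReal (r * exp (-(r * y))) * f y := by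
  have hm : Measurable (exponentialPDF r) := (measurable_exponentialPDFReal r).ennreal_ofReal
  rw [expMeasure_eq_withDensity, setLIntegral_withDensity_eq_setLIntegral_mul _ hm hf
    measurableSet_Ioi]
  refine setLIntegral_congr_fun measurableSet_Ioi fun y hy => ?_
  simp only [Pi.mul_apply]
  rw [exponentialPDF_of_nonneg (hθ.trans (le_of_lt hy))]

/-- The integral over `(θ, ∞)` of an exponential density of rate `r` against the distribution
function of an exponential variable of rate `s`, shifted by `τ`. -/
theorem integral_Ioi_exp_mul_one_sub_exp {r s : ℝ} (hr : 0 < r) (hs : 0 < s) (τ θ : ℝ) :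
    IntegrableOn (fun y => r * exp (-(r * y)) * (1 - exp (-(s * (y - τ))))) (Set.Ioi θ) ∧
    ∫ y in Set.Ioi θ, r * exp (-(r * y)) * (1 - exp (-(s * (y - τ))))
      = exp (-(r * θ)) - r / (r + s) * exp (s * τ - (r + s) * θ) := by
  have hrs : 0 < r + s := add_pos hr hs
  have key : (fun y => r * exp (-(r * y)) * (1 - exp (-(s * (y - τ)))))
      = fun y => r * exp (-r * y) - r * exp (s * τ) * exp (-(r + s) * y) := by
    funext y
    rw [mul_sub, mul_one, mul_assoc, ← exp_add, mul_assoc, ← exp_add]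
    ring_nf
  have h₁ := (integrableOn_exp_mul_Ioi (neg_lt_zero.2 hr) θ).const_mul r
  have h₂ := (integrableOn_exp_mul_Ioi (neg_lt_zero.2 hrs) θ).const_mul (r * exp (s * τ))
  rw [key]
  refine ⟨h₁.sub h₂, ?_⟩
  rw [integral_sub h₁ h₂, integral_const_mul, integral_const_mul,
    integral_exp_mul_Ioi (neg_lt_zero.2 hr), integral_exp_mul_Ioi (neg_lt_zero.2 hrs),
    sub_eq_add_neg (s * τ), exp_add, neg_mul, neg_mul]
  field_simp

/-- Joint probability for two independent exponential r.v.s `Y` (mean `a`) and `G` (mean `b`):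
`ℙ(Y > θ ∧ G < (Y - τ)/c)` in closed form, for `θ ≥ τ > 0` and `c > 0`. -/
theorem prob_exp_threshold_and_residual_interference
    {α : Type*} [MeasureSpace α] [IsProbabilityMeasure (ℙ : Measure α)]
    (Y G : α → ℝ) (a b τ c θ : ℝ)
    (ha : 0 < a) (hb : 0 < b) (hτ : 0 < τ) (hc : 0 < c) (hθ : τ ≤ θ)
    (hmY : Measurable Y) (hmG : Measurable G)
    (hY : Measure.map Y ℙ = expMeasure (1 / a))
    (hG : Measure.map G ℙ = expMeasure (1 / b))
    (hindep : IndepFun Y G ℙ) :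
    (ℙ {ω | Y ω > θ ∧ G ω < (Y ω - τ) / c}).toReal
      = Real.exp (-θ / a)
        - c * b / (a + c * b) * Real.exp (τ / (c * b) - θ * (a + c * b) / (c * b * a)) := by
  have hra : 0 < 1 / a := one_div_pos.2 ha
  have hrb : 0 < 1 / b := one_div_pos.2 hb
  have hs : 0 < 1 / (c * b) := one_div_pos.2 (mul_pos hc hb)
  have := isProbabilityMeasure_expMeasure hra
  have := isProbabilityMeasure_expMeasure hrb
  have hS : MeasurableSet {p : ℝ × ℝ | p.1 > θ ∧ p.2 < (p.1 - τ) / c} :=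
    (measurableSet_lt measurable_const measurable_fst).inter
      (measurableSet_lt measurable_snd ((measurable_fst.sub_const τ).div_const c))
  have hjoint : Measure.map (fun ω => (Y ω, G ω)) ℙ
      = (expMeasure (1 / a)).prod (expMeasure (1 / b)) := by
    rw [(indepFun_iff_map_prod_eq_prod_map_map hmY.aemeasurable hmG.aemeasurable).1 hindep, hY, hG]
  have hslice : ∀ y, expMeasure (1 / b) (Prod.mk y ⁻¹' {p : ℝ × ℝ | p.1 > θ ∧ p.2 < (p.1 - τ) / c})
      = (Set.Ioi θ).indicator
          (fun y => ENNReal.ofReal (1 - exp (-(1 / (c * b) * (y - τ))))) y := by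
    intro y
    by_cases hy : θ < y
    · have hset : Prod.mk y ⁻¹' {p : ℝ × ℝ | p.1 > θ ∧ p.2 < (p.1 - τ) / c}
          = Set.Iio ((y - τ) / c) := by
        ext g; simp [hy]
      rw [Set.indicator_of_mem (Set.mem_Ioi.2 hy), hset,
        expMeasure_Iio hrb (div_nonneg (by linarith) hc.le)]
      congr 4
      field_simp
    · rw [Set.indicator_of_notMem (by simpa using hy)]
      simp [hy]
  have hprob : ℙ {ω | Y ω > θ ∧ G ω < (Y ω - τ) / c}
      = ∫⁻ y in Set.Ioi θ, ENNReal.ofReal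
          (1 / a * exp (-(1 / a * y)) * (1 - exp (-(1 / (c * b) * (y - τ))))) := by
    change ℙ ((fun ω => (Y ω, G ω)) ⁻¹' {p : ℝ × ℝ | p.1 > θ ∧ p.2 < (p.1 - τ) / c}) = _
    rw [← Measure.map_apply (hmY.prodMk hmG) hS, hjoint, Measure.prod_apply hS,
      lintegral_congr hslice, lintegral_indicator measurableSet_Ioi,
      setLIntegral_Ioi_expMeasure (hτ.le.trans hθ) (by fun_prop)]
    refine lintegral_congr fun y => (ENNReal.ofReal_mul (by positivity)).symm
  obtain ⟨hint, hval⟩ := integral_Ioi_exp_mul_one_sub_exp hra hs τ θ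
  have hnonneg : ∀ y ∈ Set.Ioi θ,
      0 ≤ 1 / a * exp (-(1 / a * y)) * (1 - exp (-(1 / (c * b) * (y - τ)))) := by
    intro y hy
    have hy' : 0 ≤ y - τ := by linarith [Set.mem_Ioi.1 hy]
    refine mul_nonneg (by positivity) (sub_nonneg.2 (exp_le_one_iff.2 ?_))
    exact neg_nonpos.2 (mul_nonneg hs.le hy')
  rw [hprob, ← integral_eq_lintegral_of_nonneg_ae
    (ae_restrict_of_forall_mem measurableSet_Ioi hnonneg) hint.aestronglyMeasurable, hval]
  congr 2
  · ring
  · field_simp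
    ring
  · congr 1
    field_simp
    ring
end

section
/- Let ρ > 0, b_l > 0, b_t > 0, ϖ₂ ≥ 0, γ_l > 0, γ_t > 0 be real constants satisfying b_l > ϖ₂·γ_l and b_t > (b_l + ϖ₂)·γ_t. Set τ = γ_l/(ρ(b_l − ϖ₂γ_l)), ξ = γ_t/(ρ(b_t − b_l·γ_t − ϖ₂·γ_t)), and θ = max(τ, ξ). Then for all real numbers h ≥ 0 and g ≥ 0, the two inequalities ρ·h·b_t/(ρ·h·b_l + ρ·ϖ₂·h + 1) > γ_t and ρ·h·b_l/(ρ·g + ρ·ϖ₂·h + 1) > γ_l hold simultaneously if and only if h > θ and g < (h − τ)/(ρτ). -/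
/-- Deterministic equivalence of the SINR events used in the outage analysis of a
two-way relay NOMA system. -/
theorem sinr_event_equivalence
    (ρ bl bt ϖ₂ γl γt : ℝ)
    (hρ : 0 < ρ) (hbl : 0 < bl) (hbt : 0 < bt) (hϖ₂ : 0 ≤ ϖ₂)
    (hγl : 0 < γl) (hγt : 0 < γt)
    (hcondl : ϖ₂ * γl < bl) (hcondt : (bl + ϖ₂) * γt < bt)
    (τ ξ θ : ℝ)
    (hτ : τ = γl / (ρ * (bl - ϖ₂ * γl)))
    (hξ : ξ = γt / (ρ * (bt - bl * γt - ϖ₂ * γt)))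
    (hθ : θ = max τ ξ) :
    ∀ h g : ℝ, 0 ≤ h → 0 ≤ g →
      ((ρ * h * bt / (ρ * h * bl + ρ * ϖ₂ * h + 1) > γt ∧
        ρ * h * bl / (ρ * g + ρ * ϖ₂ * h + 1) > γl)
        ↔ (h > θ ∧ g < (h - τ) / (ρ * τ))) := by
  intro h g hh hg
  have hdl : 0 < ρ * (bl - ϖ₂ * γl) := mul_pos hρ (by linarith)
  have hdt : 0 < ρ * (bt - bl * γt - ϖ₂ * γt) := mul_pos hρ (by linarith)
  have hτ_pos : 0 < τ := hτ ▸ div_pos hγl hdl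
  have hfirst : ρ * h * bt / (ρ * h * bl + ρ * ϖ₂ * h + 1) > γt ↔ ξ < h := by
    rw [gt_iff_lt, lt_div_iff₀ (by positivity), hξ, div_lt_iff₀ hdt]
    constructor <;> intro H <;> linarith
  have hsecond : ρ * h * bl / (ρ * g + ρ * ϖ₂ * h + 1) > γl ↔
      g < (h - τ) / (ρ * τ) := by
    have hτ_scaled : τ * (ρ * g + 1) = γl * (ρ * g + 1) / (ρ * (bl - ϖ₂ * γl)) := by
      rw [hτ, div_mul_eq_mul_div]
    have hright : g < (h - τ) / (ρ * τ) ↔ τ * (ρ * g + 1) < h := by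
      rw [lt_div_iff₀ (mul_pos hρ hτ_pos)]
      constructor <;> intro H <;> linarith
    rw [hright, hτ_scaled, gt_iff_lt, lt_div_iff₀ (by positivity), div_lt_iff₀ hdl]
    constructor <;> intro H <;> linarith
  have hτ_lt : g < (h - τ) / (ρ * τ) → τ < h := fun H ↦ by
    rw [lt_div_iff₀ (mul_pos hρ hτ_pos)] at H
    have : 0 ≤ g * (ρ * τ) := by positivity
    linarith
  rw [hfirst, hsecond, hθ, gt_iff_lt, max_lt_iff]
  tauto
end

section
/- (Error floor for x_l with perfect SIC.) Fix Ω_l, Ω_t, Ω_k, Ω_r > 0, a_l, a_t, a_k, a_r > 0, ϖ₁ > 0, ϖ₂ ≥ 0, b_l, b_t > 0, γ_l, γ_t > 0 with b_l > ϖ₂·γ_l and b_t > (b_l + ϖ₂)·γ_t, and set μ₁ = 1/(a_t·Ω_t), μ₂ = 1/(ϖ₁·a_k·Ω_k), μ₃ = 1/(ϖ₁·a_r·Ω_r), assumed pairwise distinct, and ν = γ_l/a_l. For ρ > 0 define P(ρ) = 1 − e^{−β_l(ρ)/Ω_l − θ(ρ)/Ω_k} · λ₁(ρ)λ₂(ρ)λ₃(ρ)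 · ( Φ₁(ρ)·Ω_l/(Ω_l·λ₁(ρ) + β_l(ρ)) − Φ₂(ρ)·Ω_l/(Ω_l·λ₂(ρ) + β_l(ρ)) + Φ₃(ρ)·Ω_l/(Ω_l·λ₃(ρ) + β_l(ρ)) ), where λᵢ(ρ) = μᵢ/ρ, β_l(ρ) = ν/ρ, θ(ρ) = max( γ_l/(ρ(b_l − ϖ₂γ_l)), γ_t/(ρ(b_t − b_l·γ_t − ϖ₂·γ_t)) ), Φ₁(ρ) = 1/((λ₂(ρ)−λ₁(ρ))(λ₃(ρ)−λ₁(ρ))), Φ₂(ρ) = 1/((λ₃(ρ)−λ₂(ρ))(λ₂(ρ)−λ₁(ρ))), Φ₃(ρ) = 1/((λ₃(ρ)−λ₁(ρ))(λ₃(ρ)−λ₂(ρ))). Then as ρ → ∞, P(ρ) converges to the constant 1 − μ₁μ₂μ₃·( Ω_l/((μ₂−μ₁)(μ₃−μ₁)(Ω_l·μ₁ + ν)) − Ω_l/((μ₃−μ₂)(μ₂−μ₁)(Ω_l·μ₂ + ν)) + Ω_l/((μ₃−μ₁)(μ₃−μ₂)(Ω_l·μ₃ + ν)) ), which does not depend on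 ρ. -/
open Filter Real

/-- Scaling every rate by `1 / ρ` multiplies a partial-fraction term by `ρ ^ 3`. -/
lemma partial_fraction_term_scaling (ρ x y u v m Ω ν : ℝ) :
    1 / ((x / ρ - y / ρ) * (u / ρ - v / ρ)) * Ω / (Ω * (m / ρ) + ν / ρ)
      = ρ ^ 3 * (Ω / ((x - y) * (u - v) * (Ω * m + ν))) := by
  rw [← sub_div, ← sub_div, ← mul_div_assoc Ω m ρ, ← add_div]
  simp only [div_eq_mul_inv, mul_inv, inv_inv, one_mul]
  ring

/-- A term inversely proportional to `ρ` vanishes as `ρ → ∞`. -/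
lemma tendsto_const_div_mul_atTop (c d : ℝ) :
    Tendsto (fun ρ : ℝ => c / (ρ * d)) atTop (nhds 0) := by
  simpa only [id_eq, div_div, mul_comm d] using
    (tendsto_const_nhds (x := c / d)).div_atTop tendsto_id

/-- Error floor for `x_l` with perfect SIC: the closed-form outage probability converges,
as the SNR `ρ → ∞`, to a constant independent of `ρ`. -/
theorem error_floor_xl_pSIC
    (Ωl Ωt Ωk Ωr al at' ak ar ϖ₁ ϖ₂ bl bt γl γt μ₁ μ₂ μ₃ ν : ℝ)
    (hΩl : 0 < Ωl) (hΩt : 0 < Ωt) (hΩk : 0 < Ωk) (hΩr : 0 < Ωr)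
    (hal : 0 < al) (hat : 0 < at') (hak : 0 < ak) (har : 0 < ar)
    (hϖ₁ : 0 < ϖ₁) (hϖ₂ : 0 ≤ ϖ₂) (hbl : 0 < bl) (hbt : 0 < bt)
    (hγl : 0 < γl) (hγt : 0 < γt)
    (hcondl : ϖ₂ * γl < bl) (hcondt : (bl + ϖ₂) * γt < bt)
    (hμ₁ : μ₁ = 1 / (at' * Ωt)) (hμ₂ : μ₂ = 1 / (ϖ₁ * ak * Ωk))
    (hμ₃ : μ₃ = 1 / (ϖ₁ * ar * Ωr))
    (h₁₂ : μ₁ ≠ μ₂) (h₁₃ : μ₁ ≠ μ₃) (h₂₃ : μ₂ ≠ μ₃)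
    (hν : ν = γl / al)
    (P : ℝ → ℝ)
    (hP : ∀ ρ > (0 : ℝ), P ρ =
      1 - Real.exp (-(ν / ρ) / Ωl
            - max (γl / (ρ * (bl - ϖ₂ * γl))) (γt / (ρ * (bt - bl * γt - ϖ₂ * γt))) / Ωk)
          * (μ₁ / ρ * (μ₂ / ρ) * (μ₃ / ρ))
          * (1 / ((μ₂ / ρ - μ₁ / ρ) * (μ₃ / ρ - μ₁ / ρ)) * Ωl / (Ωl * (μ₁ / ρ) + ν / ρ)
              - 1 / ((μ₃ / ρ - μ₂ / ρ) * (μ₂ / ρ - μ₁ / ρ)) * Ωl / (Ωl * (μ₂ / ρ) + ν / ρ)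
              + 1 / ((μ₃ / ρ - μ₁ / ρ) * (μ₃ / ρ - μ₂ / ρ)) * Ωl / (Ωl * (μ₃ / ρ) + ν / ρ))) :
    Tendsto P atTop (nhds
      (1 - μ₁ * μ₂ * μ₃ *
        (Ωl / ((μ₂ - μ₁) * (μ₃ - μ₁) * (Ωl * μ₁ + ν))
          - Ωl / ((μ₃ - μ₂) * (μ₂ - μ₁) * (Ωl * μ₂ + ν))
          + Ωl / ((μ₃ - μ₁) * (μ₃ - μ₂) * (Ωl * μ₃ + ν))))) := by
  have hexp : Tendsto (fun ρ : ℝ => Real.exp (-(ν / ρ) / Ωl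
      - max (γl / (ρ * (bl - ϖ₂ * γl))) (γt / (ρ * (bt - bl * γt - ϖ₂ * γt))) / Ωk))
      atTop (nhds 1) := by
    have hν0 : Tendsto (fun ρ : ℝ => ν / ρ) atTop (nhds 0) :=
      tendsto_const_nhds.div_atTop tendsto_id
    have hmax := (tendsto_const_div_mul_atTop γl (bl - ϖ₂ * γl)).max
      (tendsto_const_div_mul_atTop γt (bt - bl * γt - ϖ₂ * γt))
    simpa using ((hν0.neg.div_const Ωl).sub (hmax.div_const Ωk)).rexp
  have hlim := (hexp.mul_const (μ₁ * μ₂ * μ₃ *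
        (Ωl / ((μ₂ - μ₁) * (μ₃ - μ₁) * (Ωl * μ₁ + ν))
          - Ωl / ((μ₃ - μ₂) * (μ₂ - μ₁) * (Ωl * μ₂ + ν))
          + Ωl / ((μ₃ - μ₁) * (μ₃ - μ₂) * (Ωl * μ₃ + ν))))).const_sub 1
  rw [one_mul] at hlim
  refine hlim.congr' ?_
  filter_upwards [eventually_gt_atTop 0] with ρ hρ
  have hscale : μ₁ / ρ * (μ₂ / ρ) * (μ₃ / ρ) * ρ ^ 3 = μ₁ * μ₂ * μ₃ := by
    field_simp
  rw [hP ρ hρ, ← hscale]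
  simp only [partial_fraction_term_scaling]
  ring
end

section
/- (Error floor for x_l with imperfect SIC.) Fix Ω_l, Ω_t, Ω_k, Ω_r, Ω_I > 0, a_l, a_t, a_k, a_r > 0, ϖ₁ > 0, ϖ₂ ≥ 0, b_l, b_t > 0, γ_l, γ_t > 0 with b_l > ϖ₂·γ_l and b_t > (b_l + ϖ₂)·γ_t, and set μ₁ = 1/(a_t·Ω_t), μ₂ = 1/(ϖ₁·a_k·Ω_k), μ₃ = 1/(ϖ₁·a_r·Ω_r), assumed pairwise distinct, ν = γ_l/a_l, and T = γ_l/(b_l − ϖ₂·γ_l). For ρ > 0 define P(ρ) = 1 − e^{−β_l(ρ)/Ω_l} · λ₁(ρ)λ₂(ρ)λ₃(ρ) · ( Φ₁(ρ)·Ω_l/(Ω_l·λ₁(ρ) + β_l(ρ)) − Φ₂(ρ)·Ω_l/(Ω_l·λ₂(ρ) + β_l(ρ)) + Φ₃(ρ)·Ω_l/(Ω_l·λ₃(ρ) + β_l(ρ)) ) · ( e^{−θ(ρ)/Ω_k} − (ρ·τ(ρ)·Ω_I/(Ω_k + ρ·τ(ρ)·Ω_I)) · e^{ −θ(ρ)·(Ω_k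 + ρ·τ(ρ)·Ω_I)/(ρ·τ(ρ)·Ω_I·Ω_k) + 1/(ρ·Ω_I) } ), where λᵢ(ρ) = μᵢ/ρ, β_l(ρ) = ν/ρ, τ(ρ) = T/ρ, θ(ρ) = max( τ(ρ), γ_t/(ρ(b_t − b_l·γ_t − ϖ₂·γ_t)) ), and Φ₁, Φ₂, Φ₃ are as in the three-exponential partial-fraction coefficients Φ₁(ρ) = 1/((λ₂(ρ)−λ₁(ρ))(λ₃(ρ)−λ₁(ρ))), Φ₂(ρ) = 1/((λ₃(ρ)−λ₂(ρ))(λ₂(ρ)−λ₁(ρ))), Φ₃(ρ) = 1/((λ₃(ρ)−λ₁(ρ))(λ₃(ρ)−λ₂(ρ))). Then as ρ → ∞, P(ρ) converges to the constant 1 − [ μ₁μ₂μ₃·( Ω_l/((μ₂−μ₁)(μ₃−μ₁)(Ω_l·μ₁ + ν)) − Ω_l/((μ₃−μ₂)(μ₂−μ₁)(Ω_l·μ₂ + ν)) + Ω_l/((μ₃−μ₁)(μ₃−μ₂)(Ω_l·μ₃ + ν)) ) ] · ( Ω_k/(Ω_k + T·Ω_I) ), which does not depend on ρ. -/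
open Filter Real

/-- Error floor for `x_l` with imperfect SIC: the closed-form outage probability converges,
as the SNR `ρ → ∞`, to a constant independent of `ρ`. -/
theorem error_floor_xl_ipSIC
    (Ωl Ωt Ωk Ωr ΩI al at' ak ar ϖ₁ ϖ₂ bl bt γl γt μ₁ μ₂ μ₃ ν T : ℝ)
    (hΩl : 0 < Ωl) (hΩt : 0 < Ωt) (hΩk : 0 < Ωk) (hΩr : 0 < Ωr) (hΩI : 0 < ΩI)
    (hal : 0 < al) (hat : 0 < at') (hak : 0 < ak) (har : 0 < ar)
    (hϖ₁ : 0 < ϖ₁) (hϖ₂ : 0 ≤ ϖ₂) (hbl : 0 < bl) (hbt : 0 < bt)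
    (hγl : 0 < γl) (hγt : 0 < γt)
    (hcondl : ϖ₂ * γl < bl) (hcondt : (bl + ϖ₂) * γt < bt)
    (hμ₁ : μ₁ = 1 / (at' * Ωt)) (hμ₂ : μ₂ = 1 / (ϖ₁ * ak * Ωk))
    (hμ₃ : μ₃ = 1 / (ϖ₁ * ar * Ωr))
    (h₁₂ : μ₁ ≠ μ₂) (h₁₃ : μ₁ ≠ μ₃) (h₂₃ : μ₂ ≠ μ₃)
    (hν : ν = γl / al) (hT : T = γl / (bl - ϖ₂ * γl))
    (P : ℝ → ℝ)
    (hP : ∀ ρ > (0 : ℝ), P ρ =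
      1 - Real.exp (-(ν / ρ) / Ωl)
          * (μ₁ / ρ * (μ₂ / ρ) * (μ₃ / ρ))
          * (1 / ((μ₂ / ρ - μ₁ / ρ) * (μ₃ / ρ - μ₁ / ρ)) * Ωl / (Ωl * (μ₁ / ρ) + ν / ρ)
              - 1 / ((μ₃ / ρ - μ₂ / ρ) * (μ₂ / ρ - μ₁ / ρ)) * Ωl / (Ωl * (μ₂ / ρ) + ν / ρ)
              + 1 / ((μ₃ / ρ - μ₁ / ρ) * (μ₃ / ρ - μ₂ / ρ)) * Ωl / (Ωl * (μ₃ / ρ) + ν / ρ))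
          * (Real.exp (-(max (T / ρ) (γt / (ρ * (bt - bl * γt - ϖ₂ * γt)))) / Ωk)
              - ρ * (T / ρ) * ΩI / (Ωk + ρ * (T / ρ) * ΩI)
                * Real.exp (-(max (T / ρ) (γt / (ρ * (bt - bl * γt - ϖ₂ * γt))))
                      * (Ωk + ρ * (T / ρ) * ΩI) / (ρ * (T / ρ) * ΩI * Ωk)
                    + 1 / (ρ * ΩI)))) :
    Tendsto P atTop (nhds
      (1 - μ₁ * μ₂ * μ₃ *
          (Ωl / ((μ₂ - μ₁) * (μ₃ - μ₁) * (Ωl * μ₁ + ν))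
            - Ωl / ((μ₃ - μ₂) * (μ₂ - μ₁) * (Ωl * μ₂ + ν))
            + Ωl / ((μ₃ - μ₁) * (μ₃ - μ₂) * (Ωl * μ₃ + ν)))
          * (Ωk / (Ωk + T * ΩI)))) := by
  have hT0 : 0 < T := hT ▸ div_pos hγl (by linarith)
  set M := max T (γt / (bt - bl * γt - ϖ₂ * γt))
  set A := μ₁ * μ₂ * μ₃ *
    (Ωl / ((μ₂ - μ₁) * (μ₃ - μ₁) * (Ωl * μ₁ + ν))
      - Ωl / ((μ₃ - μ₂) * (μ₂ - μ₁) * (Ωl * μ₂ + ν))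
      + Ωl / ((μ₃ - μ₁) * (μ₃ - μ₂) * (Ωl * μ₃ + ν))) with hA
  -- In the variable `x = ρ⁻¹` the outage probability extends continuously to `x = 0`.
  let F : ℝ → ℝ := fun x =>
    1 - Real.exp (-(ν * x) / Ωl) * A
      * (Real.exp (-(M * x) / Ωk)
        - T * ΩI / (Ωk + T * ΩI)
          * Real.exp (-(M * x) * (Ωk + T * ΩI) / (T * ΩI * Ωk) + x / ΩI))
  have hF : Continuous F := by fun_prop
  have hF0 : F 0 = 1 - A * (Ωk / (Ωk + T * ΩI)) := by
    have h : Ωk + T * ΩI ≠ 0 := by positivity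
    simp only [F, mul_zero, neg_zero, zero_div, zero_mul, add_zero, Real.exp_zero]
    field_simp
    ring
  rw [← hF0]
  refine ((hF.tendsto 0).comp tendsto_inv_atTop_zero).congr' ?_
  filter_upwards [eventually_gt_atTop 0] with ρ hρ
  have hρ0 : ρ ≠ 0 := hρ.ne'
  have hmax : max (T / ρ) (γt / (ρ * (bt - bl * γt - ϖ₂ * γt))) = M * ρ⁻¹ := by
    rw [mul_comm ρ, ← div_div, max_div_div_right hρ.le, div_eq_mul_inv]
  have hcoef : μ₁ / ρ * (μ₂ / ρ) * (μ₃ / ρ)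
      * (1 / ((μ₂ / ρ - μ₁ / ρ) * (μ₃ / ρ - μ₁ / ρ)) * Ωl / (Ωl * (μ₁ / ρ) + ν / ρ)
        - 1 / ((μ₃ / ρ - μ₂ / ρ) * (μ₂ / ρ - μ₁ / ρ)) * Ωl / (Ωl * (μ₂ / ρ) + ν / ρ)
        + 1 / ((μ₃ / ρ - μ₁ / ρ) * (μ₃ / ρ - μ₂ / ρ)) * Ωl / (Ωl * (μ₃ / ρ) + ν / ρ)) = A := by
    have hterm (a b c : ℝ) : 1 / (a / ρ * (b / ρ)) * Ωl / (c / ρ)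
        = ρ ^ 3 * (Ωl / (a * b * c)) := by
      simp only [div_eq_mul_inv, mul_inv, inv_inv]
      ring
    simp only [← mul_div_assoc, ← sub_div, ← add_div] at hterm ⊢
    simp only [hterm]
    rw [hA]
    field_simp
  have hτ : ρ * (T / ρ) = T := mul_div_cancel₀ T hρ0
  have hone : 1 / (ρ * ΩI) = ρ⁻¹ / ΩI := by rw [← div_div, one_div]
  rw [hP ρ hρ, hmax, hτ, hone, mul_assoc (Real.exp (-(ν / ρ) / Ωl)), hcoef, div_eq_mul_inv ν ρ]
  rfl
end

section
/- (Error floor for x_t with perfect SIC.) Fix Ω_l, Ω_t, Ω_k, Ω_r > 0, a_l, a_t, a_k, a_r > 0, ϖ₁ > 0, ϖ₂ ≥ 0, b_l, b_t > 0, γ_l, γ_t > 0 with b_t > (b_l + ϖ₂)·γ_t, and set μ'₁ = 1/(ϖ₁·a_k·Ω_k), μ'₂ = 1/(ϖ₁·a_r·Ω_r) with μ'₁ ≠ μ'₂, ν_l = γ_l/a_l, ν_t = γ_t/a_t, and φ∞ = (Ω_l + ν_l·a_t·Ω_t)/(Ω_l·Ω_t). For ρ > 0 define P(ρ) = 1 −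 [ e^{−β_l(ρ)/Ω_l − β_t(ρ)·φ(ρ) − ξ(ρ)/Ω_k − ξ(ρ)/Ω_r} / ( φ(ρ)·Ω_t·(λ'₂(ρ) − λ'₁(ρ)) ) ] · λ'₁(ρ)·λ'₂(ρ) · ( Ω_l/(β_l(ρ) + β_t(ρ)·Ω_l·φ(ρ) + Ω_l·λ'₁(ρ)) − Ω_l/(β_l(ρ) + β_t(ρ)·Ω_l·φ(ρ) + Ω_l·λ'₂(ρ)) ), where λ'ᵢ(ρ) = μ'ᵢ/ρ, β_l(ρ) = ν_l/ρ, β_t(ρ) = ν_t/ρ, φ(ρ) = (Ω_l + ρ·β_l(ρ)·a_t·Ω_t)/(Ω_l·Ω_t), and ξ(ρ) = γ_t/(ρ(b_t − b_l·γ_t − ϖ₂·γ_t)). Then as ρ → ∞, P(ρ) converges to the constant 1 − [ μ'₁·μ'₂ / ( φ∞·Ω_t·(μ'₂ − μ'₁) ) ] · ( Ω_l/(ν_l + ν_t·Ω_l·φ∞ + Ω_l·μ'₁) − Ω_l/(ν_l + ν_t·Ω_l·φ∞ + Ω_l·μ'₂) ), which does not depend on ρ. -/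
open Filter Real

/-- Error floor for `x_t` with perfect SIC: the closed-form outage probability converges,
as the SNR `ρ → ∞`, to a constant independent of `ρ`. -/
theorem error_floor_xt_pSIC
    (Ωl Ωt Ωk Ωr al at' ak ar ϖ₁ ϖ₂ bl bt γl γt μ₁' μ₂' νl νt φinf : ℝ)
    (hΩl : 0 < Ωl) (hΩt : 0 < Ωt) (hΩk : 0 < Ωk) (hΩr : 0 < Ωr)
    (hal : 0 < al) (hat : 0 < at') (hak : 0 < ak) (har : 0 < ar)
    (hϖ₁ : 0 < ϖ₁) (hϖ₂ : 0 ≤ ϖ₂) (hbl : 0 < bl) (hbt : 0 < bt)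
    (hγl : 0 < γl) (hγt : 0 < γt)
    (hcondt : (bl + ϖ₂) * γt < bt)
    (hμ₁ : μ₁' = 1 / (ϖ₁ * ak * Ωk)) (hμ₂ : μ₂' = 1 / (ϖ₁ * ar * Ωr))
    (h₁₂ : μ₁' ≠ μ₂')
    (hνl : νl = γl / al) (hνt : νt = γt / at')
    (hφinf : φinf = (Ωl + νl * at' * Ωt) / (Ωl * Ωt))
    (P : ℝ → ℝ)
    (hP : ∀ ρ > (0 : ℝ), P ρ =
      1 - Real.exp (-(νl / ρ) / Ωl
              - νt / ρ * ((Ωl + ρ * (νl / ρ) * at' * Ωt) / (Ωl * Ωt))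
              - γt / (ρ * (bt - bl * γt - ϖ₂ * γt)) / Ωk
              - γt / (ρ * (bt - bl * γt - ϖ₂ * γt)) / Ωr)
            / ((Ωl + ρ * (νl / ρ) * at' * Ωt) / (Ωl * Ωt) * Ωt * (μ₂' / ρ - μ₁' / ρ))
          * (μ₁' / ρ * (μ₂' / ρ))
          * (Ωl / (νl / ρ + νt / ρ * Ωl * ((Ωl + ρ * (νl / ρ) * at' * Ωt) / (Ωl * Ωt))
                + Ωl * (μ₁' / ρ))
              - Ωl / (νl / ρ + νt / ρ * Ωl * ((Ωl + ρ * (νl / ρ) * at' * Ωt) / (Ωl * Ωt))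
                + Ωl * (μ₂' / ρ)))) :
    Tendsto P atTop (nhds
      (1 - μ₁' * μ₂' / (φinf * Ωt * (μ₂' - μ₁'))
          * (Ωl / (νl + νt * Ωl * φinf + Ωl * μ₁')
              - Ωl / (νl + νt * Ωl * φinf + Ωl * μ₂')))) := by
  set d := bt - bl * γt - ϖ₂ * γt
  set K := μ₁' * μ₂' / (φinf * Ωt * (μ₂' - μ₁'))
          * (Ωl / (νl + νt * Ωl * φinf + Ωl * μ₁')
              - Ωl / (νl + νt * Ωl * φinf + Ωl * μ₂')) with hK
  set C := -νl / Ωl - νt * φinf - γt / d / Ωk - γt / d / Ωr with hC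
  have hlim : Tendsto (fun ρ : ℝ => 1 - Real.exp (C * ρ⁻¹) * K) atTop (nhds (1 - K)) := by
    have hexp : Tendsto (fun ρ : ℝ => Real.exp (C * ρ⁻¹)) atTop (nhds 1) := by
      simpa [Function.comp_def] using
        (Real.continuous_exp.tendsto _).comp (tendsto_inv_atTop_zero.const_mul C)
    simpa using (hexp.mul_const K).const_sub 1
  refine hlim.congr' ?_
  filter_upwards [eventually_gt_atTop 0] with ρ hρ
  have hscale (μ : ℝ) : Ωl / (νl / ρ + νt / ρ * Ωl * φinf + Ωl * (μ / ρ))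
      = ρ * (Ωl / (νl + νt * Ωl * φinf + Ωl * μ)) := by
    rw [show νl / ρ + νt / ρ * Ωl * φinf + Ωl * (μ / ρ)
      = (νl + νt * Ωl * φinf + Ωl * μ) / ρ by ring, div_div_eq_mul_div]
    ring
  have hexponent : -(νl / ρ) / Ωl - νt / ρ * φinf - γt / (ρ * d) / Ωk - γt / (ρ * d) / Ωr
      = C * ρ⁻¹ := by
    rw [hC]
    field_simp
  rw [hP ρ hρ, mul_div_cancel₀ νl hρ.ne', ← hφinf, hscale, hscale, hexponent, hK,
    ← sub_div, ← mul_sub]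
  field_simp
end

section
/- (Error floor for x_t with imperfect SIC.) Fix Ω_l, Ω_t, Ω_k, Ω_r, Ω_I > 0, a_l, a_t, a_k, a_r > 0, ϖ₁ > 0, ϖ₂ ≥ 0, b_l, b_t > 0, γ_l, γ_t > 0 with b_t > (b_l + ϖ₂)·γ_t, and set μ'₁ = 1/(ϖ₁·a_k·Ω_k), μ'₂ = 1/(ϖ₁·a_r·Ω_r) with μ'₁ ≠ μ'₂, ν_l = γ_l/a_l, ν_t = γ_t/a_t, and φ∞ = (Ω_l + ν_l·a_t·Ω_t)/(Ω_l·Ω_t). For ρ > 0 define P(ρ) = 1 − [ e^{−β_l(ρ)/Ω_l − β_t(ρ)·φ(ρ) − ξ(ρ)/Ω_k − ξ(ρ)/Ω_r} / ( φ(ρ)·Ω_t·(1 + ρ·β_t(ρ)·φ(ρ)·Ω_I)·(λ'₂(ρ) − λ'₁(ρ)) ) ] · λ'₁(ρ)·λ'₂(ρ) · ( Ω_l/(β_l(ρ) + β_t(ρ)·Ω_l·φ(ρ) + Ω_l·λ'₁(ρ)) − Ω_l/(β_l(ρ) + β_t(ρ)·Ω_l·φ(ρ) + Ω_l·λ'₂(ρ))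 ), where λ'ᵢ(ρ) = μ'ᵢ/ρ, β_l(ρ) = ν_l/ρ, β_t(ρ) = ν_t/ρ, φ(ρ) = (Ω_l + ρ·β_l(ρ)·a_t·Ω_t)/(Ω_l·Ω_t), and ξ(ρ) = γ_t/(ρ(b_t − b_l·γ_t − ϖ₂·γ_t)). Then as ρ → ∞, P(ρ) converges to the constant 1 − [ μ'₁·μ'₂ / ( φ∞·Ω_t·(1 + ν_t·φ∞·Ω_I)·(μ'₂ − μ'₁) ) ] · ( Ω_l/(ν_l + ν_t·Ω_l·φ∞ + Ω_l·μ'₁) − Ω_l/(ν_l + ν_t·Ω_l·φ∞ + Ω_l·μ'₂) ), which does not depend on ρ. -/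
open Filter Real

/-- Error floor for `x_t` with imperfect SIC: the closed-form outage probability converges,
as the SNR `ρ → ∞`, to a constant independent of `ρ`. -/
theorem error_floor_xt_ipSIC
    (Ωl Ωt Ωk Ωr ΩI al at' ak ar ϖ₁ ϖ₂ bl bt γl γt μ₁' μ₂' νl νt φinf : ℝ)
    (hΩl : 0 < Ωl) (hΩt : 0 < Ωt) (hΩk : 0 < Ωk) (hΩr : 0 < Ωr) (hΩI : 0 < ΩI)
    (hal : 0 < al) (hat : 0 < at') (hak : 0 < ak) (har : 0 < ar)
    (hϖ₁ : 0 < ϖ₁) (hϖ₂ : 0 ≤ ϖ₂) (hbl : 0 < bl) (hbt : 0 < bt)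
    (hγl : 0 < γl) (hγt : 0 < γt)
    (hcondt : (bl + ϖ₂) * γt < bt)
    (hμ₁ : μ₁' = 1 / (ϖ₁ * ak * Ωk)) (hμ₂ : μ₂' = 1 / (ϖ₁ * ar * Ωr))
    (h₁₂ : μ₁' ≠ μ₂')
    (hνl : νl = γl / al) (hνt : νt = γt / at')
    (hφinf : φinf = (Ωl + νl * at' * Ωt) / (Ωl * Ωt))
    (P : ℝ → ℝ)
    (hP : ∀ ρ > (0 : ℝ), P ρ =
      1 - Real.exp (-(νl / ρ) / Ωl
              - νt / ρ * ((Ωl + ρ * (νl / ρ) * at' * Ωt) / (Ωl * Ωt))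
              - γt / (ρ * (bt - bl * γt - ϖ₂ * γt)) / Ωk
              - γt / (ρ * (bt - bl * γt - ϖ₂ * γt)) / Ωr)
            / ((Ωl + ρ * (νl / ρ) * at' * Ωt) / (Ωl * Ωt) * Ωt
                * (1 + ρ * (νt / ρ) * ((Ωl + ρ * (νl / ρ) * at' * Ωt) / (Ωl * Ωt)) * ΩI)
                * (μ₂' / ρ - μ₁' / ρ))
          * (μ₁' / ρ * (μ₂' / ρ))
          * (Ωl / (νl / ρ + νt / ρ * Ωl * ((Ωl + ρ * (νl / ρ) * at' * Ωt) / (Ωl * Ωt))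
                + Ωl * (μ₁' / ρ))
              - Ωl / (νl / ρ + νt / ρ * Ωl * ((Ωl + ρ * (νl / ρ) * at' * Ωt) / (Ωl * Ωt))
                + Ωl * (μ₂' / ρ)))) :
    Tendsto P atTop (nhds
      (1 - μ₁' * μ₂' / (φinf * Ωt * (1 + νt * φinf * ΩI) * (μ₂' - μ₁'))
          * (Ωl / (νl + νt * Ωl * φinf + Ωl * μ₁')
              - Ωl / (νl + νt * Ωl * φinf + Ωl * μ₂')))) := by
  have hlim : Tendsto (fun ρ : ℝ => Real.exp ((-νl / Ωl - νt * φinf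
      - γt / (bt - bl * γt - ϖ₂ * γt) / Ωk - γt / (bt - bl * γt - ϖ₂ * γt) / Ωr) * ρ⁻¹))
      atTop (nhds 1) := by
    simpa using (tendsto_inv_atTop_zero.const_mul (-νl / Ωl - νt * φinf
      - γt / (bt - bl * γt - ϖ₂ * γt) / Ωk - γt / (bt - bl * γt - ϖ₂ * γt) / Ωr)).rexp
  have hmain := (hlim.mul_const
    (μ₁' * μ₂' / (φinf * Ωt * (1 + νt * φinf * ΩI) * (μ₂' - μ₁'))
      * (Ωl / (νl + νt * Ωl * φinf + Ωl * μ₁')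
        - Ωl / (νl + νt * Ωl * φinf + Ωl * μ₂')))).const_sub 1
  rw [one_mul] at hmain
  refine hmain.congr' ?_
  filter_upwards [eventually_gt_atTop 0] with ρ hρ
  have hρ0 : ρ ≠ 0 := hρ.ne'
  rw [hP ρ hρ, mul_div_cancel₀ νl hρ0, mul_div_cancel₀ νt hρ0, ← hφinf]
  have hexponent : -(νl / ρ) / Ωl - νt / ρ * φinf
      - γt / (ρ * (bt - bl * γt - ϖ₂ * γt)) / Ωk - γt / (ρ * (bt - bl * γt - ϖ₂ * γt)) / Ωr
      = (-νl / Ωl - νt * φinf - γt / (bt - bl * γt - ϖ₂ * γt) / Ωk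
        - γt / (bt - bl * γt - ϖ₂ * γt) / Ωr) * ρ⁻¹ := by
    generalize bt - bl * γt - ϖ₂ * γt = d
    ring
  have hden (m : ℝ) : νl / ρ + νt / ρ * Ωl * φinf + Ωl * (m / ρ)
      = (νl + νt * Ωl * φinf + Ωl * m) / ρ := by ring
  rw [hexponent, hden, hden, ← sub_div, div_div_eq_mul_div, div_div_eq_mul_div]
  generalize φinf * Ωt * (1 + νt * φinf * ΩI) = A
  generalize μ₂' - μ₁' = B
  generalize νl + νt * Ωl * φinf + Ωl * μ₁' = D₁
  generalize νl + νt * Ωl * φinf + Ωl * μ₂' = D₂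
  rw [mul_div_assoc', div_div_eq_mul_div]
  field_simp
end

section
/- Let Y and G be independent random variables on a probability space, where Y is exponentially distributed with mean Ω_k > 0 and G is exponentially distributed with mean Ω_I > 0. Let T > 0 be a constant, and for ρ > 0 define the event E(ρ) = { Y > θ(ρ) and G < (Y − T/ρ)/T } where θ(ρ) = max(T, Ξ)/ρ for some constant Ξ > 0. Then lim_{ρ→∞} ℙ(E(ρ)) = ℙ( G < Y/T ) = Ω_k/(Ω_k + T·Ω_I). -/
open MeasureTheory ProbabilityTheory Filter Real

open scoped ENNReal

lemma expMeasure_Ioi {r x : ℝ} (hr : 0 < r) (hx : 0 ≤ x) :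
    expMeasure r (Set.Ioi x) = ENNReal.ofReal (exp (-(r * x))) := by
  have := isProbabilityMeasure_expMeasure hr
  have h := probReal_compl_eq_one_sub (μ := expMeasure r) (measurableSet_Iic (a := x))
  rw [← cdf_eq_real, cdf_expMeasure_eq hr, if_pos hx, Set.compl_Iic, sub_sub_cancel] at h
  rw [← h, ofReal_measureReal]

lemma lintegral_expMeasure (r : ℝ) (f : ℝ → ℝ≥0∞) (hf : Measurable f) :
    ∫⁻ x, f x ∂expMeasure r = ∫⁻ x, exponentialPDF r x * f x :=
  lintegral_withDensity_eq_lintegral_mul _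
    (measurable_exponentialPDFReal r).ennreal_ofReal hf

lemma ae_nonneg_expMeasure (r : ℝ) : ∀ᵐ x ∂expMeasure r, 0 ≤ x := by
  have h : expMeasure r (Set.Iio 0) = 0 := by
    rw [expMeasure, gammaMeasure, withDensity_apply _ measurableSet_Iio]
    exact lintegral_gammaPDF_of_nonpos le_rfl
  simpa [ae_iff, Set.Iio] using h

lemma ae_pos_expMeasure {r : ℝ} (hr : 0 < r) : ∀ᵐ x ∂expMeasure r, 0 < x := by
  have := isProbabilityMeasure_expMeasure hr
  have h : expMeasure r (Set.Ioi 0) = 1 := by simp [expMeasure_Ioi hr le_rfl]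
  exact (mem_ae_iff_prob_eq_one measurableSet_Ioi).2 h

/-- The Laplace transform of the exponential distribution. -/
lemma lintegral_exp_neg_mul_expMeasure {a b : ℝ} (ha : 0 < a) (hb : 0 < b) :
    ∫⁻ x, ENNReal.ofReal (exp (-(b * x))) ∂expMeasure a = ENNReal.ofReal (a / (a + b)) := by
  have hab : 0 < a + b := add_pos ha hb
  rw [lintegral_expMeasure _ _ (by fun_prop)]
  calc ∫⁻ x, exponentialPDF a x * ENNReal.ofReal (exp (-(b * x)))
      = ∫⁻ x, ENNReal.ofReal (a / (a + b)) * exponentialPDF (a + b) x := by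
        congr 1 with x
        rcases lt_or_ge x 0 with hx | hx
        · simp [exponentialPDF_of_neg hx]
        · rw [exponentialPDF_of_nonneg hx, exponentialPDF_of_nonneg hx,
            ← ENNReal.ofReal_mul (by positivity), ← ENNReal.ofReal_mul (by positivity)]
          rw [mul_assoc, ← exp_add, show -(a * x) + -(b * x) = -((a + b) * x) by ring]
          congr 1
          field_simp
    _ = ENNReal.ofReal (a / (a + b)) := by
        rw [lintegral_const_mul' _ _ ENNReal.ofReal_ne_top, lintegral_exponentialPDF_eq_one hab,
          mul_one]

/-- The probability that `T * G < Y` for independent exponential variables `Y` and `G`. -/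
lemma prod_expMeasure_setOf_mul_lt {a b T : ℝ} (ha : 0 < a) (hb : 0 < b) (hT : 0 < T) :
    ((expMeasure b).prod (expMeasure a)) {p | T * p.2 < p.1}
      = ENNReal.ofReal (a / (a + b * T)) := by
  have := isProbabilityMeasure_expMeasure ha
  have := isProbabilityMeasure_expMeasure hb
  rw [Measure.prod_apply_symm (measurableSet_lt (by fun_prop) (by fun_prop)),
    ← lintegral_exp_neg_mul_expMeasure ha (mul_pos hb hT)]
  refine lintegral_congr_ae ?_
  filter_upwards [ae_nonneg_expMeasure a] with x hx
  rw [mul_assoc, ← expMeasure_Ioi hb (mul_nonneg hT.le hx)]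
  rfl

/-- High-SNR limit of the second factor in the outage probability of `x_l` with imperfect SIC:
as `ρ → ∞`, `ℙ(Y > max(T,Ξ)/ρ ∧ G < (Y - T/ρ)/T)` tends to `ℙ(G < Y/T) = Ωk/(Ωk + T ΩI)`. -/
theorem limit_second_factor_ipSIC
    {α : Type*} [MeasureSpace α] [IsProbabilityMeasure (ℙ : Measure α)]
    (Y G : α → ℝ) (Ωk ΩI T Ξ : ℝ)
    (hΩk : 0 < Ωk) (hΩI : 0 < ΩI) (hT : 0 < T) (hΞ : 0 < Ξ)
    (hmY : Measurable Y) (hmG : Measurable G)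
    (hY : Measure.map Y ℙ = expMeasure (1 / Ωk))
    (hG : Measure.map G ℙ = expMeasure (1 / ΩI))
    (hindep : IndepFun Y G ℙ) :
    Tendsto (fun ρ : ℝ =>
        (ℙ {ω | Y ω > max T Ξ / ρ ∧ G ω < (Y ω - T / ρ) / T}).toReal)
      atTop (nhds ((ℙ {ω | G ω < Y ω / T}).toReal))
    ∧ (ℙ {ω | G ω < Y ω / T}).toReal = Ωk / (Ωk + T * ΩI) := by
  have hYpos : ∀ᵐ ω, 0 < Y ω :=
    ae_of_ae_map hmY.aemeasurable (hY ▸ ae_pos_expMeasure (one_div_pos.2 hΩk))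
  constructor
  · refine (ENNReal.tendsto_toReal (measure_ne_top _ _)).comp ?_
    refine tendsto_measure_of_ae_tendsto_indicator_of_isFiniteMeasure atTop
      (measurableSet_lt hmG (hmY.div_const T)) (fun ρ => ?_) ?_
    · exact (measurableSet_lt measurable_const hmY).inter
        (measurableSet_lt hmG ((hmY.sub_const _).div_const T))
    · filter_upwards [hYpos] with ω hω
      by_cases h : G ω < Y ω / T
      · have h₁ : Tendsto (fun ρ : ℝ => max T Ξ / ρ) atTop (nhds 0) :=
          tendsto_const_nhds.div_atTop tendsto_id
        have h₂ : Tendsto (fun ρ : ℝ => (Y ω - T / ρ) / T) atTop (nhds (Y ω / T)) := by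
          simpa using (tendsto_const_nhds.sub
            (tendsto_const_nhds.div_atTop tendsto_id)).div_const T
        filter_upwards [h₁.eventually_lt_const hω, h₂.eventually_const_lt h] with ρ h₃ h₄
        exact iff_of_true ⟨h₃, h₄⟩ h
      · filter_upwards [eventually_gt_atTop 0] with ρ hρ
        refine iff_of_false (fun hmem => h (hmem.2.trans ?_)) h
        have := div_pos hT hρ
        gcongr
        linarith
  · have hset : {ω | G ω < Y ω / T} = (fun ω => (Y ω, G ω)) ⁻¹' {p | T * p.2 < p.1} := by
      ext ω
      simp [lt_div_iff₀' hT]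
    rw [hset, ← Measure.map_apply (hmY.prodMk hmG) (measurableSet_lt (by fun_prop) (by fun_prop)),
      hindep.map_prod_eq_prod_map_map hmY.aemeasurable hmG.aemeasurable, hY, hG,
      prod_expMeasure_setOf_mul_lt (one_div_pos.2 hΩI) (one_div_pos.2 hΩk) hT,
      ENNReal.toReal_ofReal (by positivity)]
    field_simp
end
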